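/- Let θ be an irrational number, d a nonzero integer, and f : 𝕋 → ℝ a smooth function. Then there exists a continuous map ψ : T² → T² satisfying ψ ∘ φ_{θ,d,f} = φ_{θ,d,0} ∘ ψ if and only if f splits with respect to the rotation x ↦ e^{2πiθ}x, i.e. if and only if there exists a continuous function g : 𝕋 → ℝ with g(x) − g(e^{2πiθ}x) = f(x) − η for all x ∈ 𝕋, where η is the mean value of f. -/

import Mathlib

open MeasureTheory intervalIntegral

/-- The Furstenberg transformation `φ_{θ,d,f}` of the two-torus `𝕋 × 𝕋`:
`(x, y) ↦ (x·e^{2πiθ}, x^d·y·e^{2πi f(x)})`. -/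
noncomputable def furstenberg (θ : ℝ) (d : ℤ) (f : Circle → ℝ) :
    Circle × Circle → Circle × Circle :=
  fun p => (p.1 * Circle.exp (2 * Real.pi * θ),
    p.1 ^ d * p.2 * Circle.exp (2 * Real.pi * f p.1))

/-- The mean value `η = ∫_𝕋 f dm` of a function on the circle with respect to the
normalized Haar measure, computed as `∫₀¹ f(e^{2πit}) dt`. -/
noncomputable def circleMean (f : Circle → ℝ) : ℝ :=
  ∫ t in (0:ℝ)..1, f (Circle.exp (2 * Real.pi * t))

theorem Circle.continuous_of_comp_exp {X : Type*} [TopologicalSpace X] {u : Circle → X}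
    (hu : Continuous fun t : ℝ => u (Circle.exp t)) : Continuous u :=
  (Circle.isCoveringMap_exp.isQuotientMap Circle.exp_surjective).continuous_iff.2 hu

/-- A continuous real function on a connected space is constant if its exponential is. -/
theorem Circle.eq_of_exp_comp_eq {X : Type*} [TopologicalSpace X] [PreconnectedSpace X]
    {u : X → ℝ} (hu : Continuous u) {c : Circle} (h : ∀ x, Circle.exp (u x) = c) (x y : X) :
    u x = u y :=
  Circle.isCoveringMap_exp.const_of_comp hu (fun a b => (h a).trans (h b).symm) x y

/-- Every continuous self-map of the circle is `x ↦ x ^ m` times the exponential of a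
continuous real function, where `m` is its degree. -/
theorem Circle.exists_eq_zpow_mul_exp {W : Circle → Circle} (hW : Continuous W) :
    ∃ (m : ℤ) (h : Circle → ℝ), Continuous h ∧ ∀ x, W x = x ^ m * Circle.exp (h x) := by
  obtain ⟨e₀, he₀⟩ := Circle.exp_surjective (W (Circle.exp 0))
  obtain ⟨L, ⟨-, hL⟩, -⟩ := Circle.isCoveringMap_exp.existsUnique_continuousMap_lifts
    (⟨fun t : ℝ => W (Circle.exp t), by fun_prop⟩ : C(ℝ, Circle)) 0 e₀ he₀
  have hL' : ∀ t, Circle.exp (L t) = W (Circle.exp t) := fun t => congrFun hL t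
  have hone : ∀ t, Circle.exp (L (t + 2 * Real.pi) - L t) = 1 := fun t => by
    rw [Circle.exp_sub, hL', hL', Circle.exp_add_two_pi, div_self']
  obtain ⟨m, hm⟩ := Circle.exp_eq_one.1 (hone 0)
  have hper : Function.Periodic (fun t => L t - m * t) (2 * Real.pi) := fun t => by
    have := Circle.eq_of_exp_comp_eq (by fun_prop) hone t 0
    simp only at this ⊢
    linarith
  have hlift : ∀ t, (fun x : Circle => L (Complex.arg x) - m * Complex.arg x) (Circle.exp t)
      = L t - m * t := fun t => by
    obtain ⟨k, hk⟩ := Circle.exp_eq_exp.1 (Circle.exp_arg (Circle.exp t))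
    have := hper.int_mul k t
    simp only at this ⊢
    rw [hk, this]
  refine ⟨m, fun x => L (Complex.arg x) - m * Complex.arg x,
    Circle.continuous_of_comp_exp ?_, fun x => ?_⟩
  · simp only [hlift]
    fun_prop
  · obtain ⟨t, rfl⟩ := Circle.exp_surjective x
    rw [hlift, ← Circle.exp_intCast_mul, ← Circle.exp_add, ← hL']
    congr 1
    ring

theorem Circle.eq_zero_of_zpow_eq_exp {j : ℤ} {q : Circle → ℝ} (hq : Continuous q)
    (h : ∀ x : Circle, x ^ j = Circle.exp (q x)) : j = 0 := by
  have hone : ∀ t : ℝ, Circle.exp (j * t - q (Circle.exp t)) = 1 := fun t => by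
    rw [Circle.exp_sub, Circle.exp_intCast_mul, h, div_self']
  have := Circle.eq_of_exp_comp_eq (by fun_prop) hone (2 * Real.pi) 0
  simp only [Circle.exp_two_pi, Circle.exp_zero, mul_zero] at this
  have h2 : (j : ℝ) * (2 * Real.pi) = 0 := by linarith
  simpa [Real.pi_ne_zero] using h2

theorem UnitAddCircle.toCircle_coe (t : ℝ) :
    AddCircle.toCircle (t : AddCircle (1 : ℝ)) = Circle.exp (2 * Real.pi * t) := by
  rw [AddCircle.toCircle_apply_mk, div_one]

theorem UnitAddCircle.exists_toCircle_eq (x : Circle) :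
    ∃ a : AddCircle (1 : ℝ), AddCircle.toCircle a = x := by
  obtain ⟨a, rfl⟩ := (AddCircle.homeomorphCircle (one_ne_zero (α := ℝ))).surjective x
  exact ⟨a, (AddCircle.homeomorphCircle_apply _ a).symm⟩

/-- A continuous function invariant under an irrational rotation is constant. -/
theorem Circle.eq_of_irrational_rotation_invariant {X : Type*} [TopologicalSpace X] [T2Space X]
    {θ : ℝ} (hθ : Irrational θ) {u : Circle → X} (hu : Continuous u)
    (h : ∀ x, u (x * Circle.exp (2 * Real.pi * θ)) = u x) (x : Circle) : u x = u 1 := by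
  have hpow : ∀ n : ℤ, u (Circle.exp (2 * Real.pi * θ) ^ n) = u 1 := fun n => by
    induction n with
    | zero => simp
    | succ n ih => rw [zpow_add_one, h, ih]
    | pred n ih => rw [← ih, ← h, ← zpow_add_one, sub_add_cancel]
  have hdense : DenseRange (· • (θ : AddCircle (1 : ℝ)) : ℤ → AddCircle (1 : ℝ)) :=
    AddCircle.denseRange_zsmul_coe_iff.2 (by simpa using hθ)
  have hconst : (fun a : AddCircle (1 : ℝ) => u (AddCircle.toCircle a)) = fun _ => u 1 :=
    hdense.equalizer (by fun_prop) (by fun_prop) <| funext fun n => by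
      simp only [Function.comp_apply]
      rw [AddCircle.toCircle_zsmul, UnitAddCircle.toCircle_coe, hpow]
  obtain ⟨a, rfl⟩ := UnitAddCircle.exists_toCircle_eq x
  exact congrFun hconst a

/-- A multiplicative cocycle of nonzero degree over an irrational rotation is not a coboundary. -/
theorem Circle.eq_zero_of_rotation_eq_mul {θ : ℝ} (hθ : Irrational θ) {F : Circle → ℂ}
    (hF : Continuous F) {j : ℤ} (hj : j ≠ 0) {κ : Circle → ℝ} (hκ : Continuous κ) (c : Circle)
    (h : ∀ x, F (x * Circle.exp (2 * Real.pi * θ))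
      = ((c * x ^ j * Circle.exp (κ x) : Circle) : ℂ) * F x) (x : Circle) : F x = 0 := by
  have hnorm : ∀ x, ‖F x‖ = ‖F 1‖ :=
    Circle.eq_of_irrational_rotation_invariant hθ hF.norm fun x => by
      rw [h, norm_mul, Circle.norm_coe, one_mul]
  by_contra hx
  have hr : ‖F 1‖ ≠ 0 := by rw [← hnorm x]; exact norm_ne_zero_iff.2 hx
  let W : Circle → Circle := fun x =>
    ⟨F x / (‖F 1‖ : ℂ), mem_sphere_zero_iff_norm.2 (by simp [hnorm x, hr])⟩
  have hW : Continuous W := (hF.div_const _).subtype_mk _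
  have hWrot : ∀ x, W (x * Circle.exp (2 * Real.pi * θ)) = c * x ^ j * Circle.exp (κ x) * W x :=
    fun x => Circle.ext (by rw [Circle.coe_mul]; simp only [W, h]; ring)
  obtain ⟨m, p, hp, hWp⟩ := Circle.exists_eq_zpow_mul_exp hW
  obtain ⟨r, hr⟩ := Circle.exp_surjective (Circle.exp (2 * Real.pi * θ) ^ m / c)
  refine hj (Circle.eq_zero_of_zpow_eq_exp
    (q := fun x => r + p (x * Circle.exp (2 * Real.pi * θ)) - κ x - p x) (by fun_prop) fun x => ?_)
  have := hWrot x
  rw [hWp, hWp, mul_zpow] at this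
  rw [Circle.exp_sub, Circle.exp_sub, Circle.exp_add, hr, eq_div_iff_mul_eq', eq_div_iff_mul_eq',
    div_mul_eq_mul_div, eq_div_iff_mul_eq', ← mul_right_inj (x ^ m)]
  calc _ = c * x ^ j * Circle.exp (κ x) * (x ^ m * Circle.exp (p x)) := by
        simp only [mul_assoc, mul_comm, mul_left_comm]
    _ = _ := by rw [← this]; simp only [mul_assoc]

theorem fourierCoeff_translate {T : ℝ} [Fact (0 < T)] (u : AddCircle T → ℂ) (b : AddCircle T)
    (n : ℤ) :
    fourierCoeff u n = fourier (-n) b * fourierCoeff (fun a => u (a + b)) n := by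
  rw [fourierCoeff, ← integral_add_right_eq_self _ b, fourierCoeff, ← MeasureTheory.integral_const_mul]
  congr 1 with a
  simp only [smul_eq_mul, fourier_apply, smul_add, AddCircle.toCircle_add, Circle.coe_mul]
  ring

theorem continuous_fourierCoeff_comp_toCircle {G : Circle × Circle → ℂ} (hG : Continuous G)
    (n : ℤ) :
    Continuous fun x =>
      fourierCoeff (fun a : AddCircle (1 : ℝ) => G (x, AddCircle.toCircle a)) n := by
  have := continuous_parametric_integral_of_continuous (μ := AddCircle.haarAddCircle (T := 1))
    (f := fun x (a : AddCircle (1 : ℝ)) => fourier (-n) a • G (x, AddCircle.toCircle a))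
    (by unfold Function.uncurry; fun_prop) isCompact_univ
  simpa only [Measure.restrict_univ, fourierCoeff] using this

theorem eq_fourierCoeff_mul_of_forall_ne {T : ℝ} [Fact (0 < T)] {u : AddCircle T → ℂ}
    (hu : Continuous u) {k : ℤ} (h : ∀ n ≠ k, fourierCoeff u n = 0) (a : AddCircle T) :
    u a = fourierCoeff u k * fourier k a := by
  have hsum : Summable (fourierCoeff u) := (hasSum_single k h).summable
  have h1 := has_pointwise_sum_fourier_series_of_summable (f := ⟨u, hu⟩) hsum a
  exact h1.unique (hasSum_single k fun n hn => by
    simp only [ContinuousMap.coe_mk, h n hn, zero_smul])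

/-- A continuous function on the torus on which a Furstenberg transformation acts through
multiplication by `c · x ^ (k d)` is a multiple of `y ^ k` on each fibre. -/
theorem eq_mul_zpow_of_furstenberg {θ : ℝ} (hθ : Irrational θ) {d : ℤ} (hd : d ≠ 0)
    {f : Circle → ℝ} (hf : Continuous f) {G : Circle × Circle → Circle} (hG : Continuous G)
    (c : Circle) (k : ℤ)
    (h : ∀ x y, G (furstenberg θ d f (x, y)) = c * x ^ (k * d) * G (x, y)) (x y : Circle) :
    G (x, y) = G (x, 1) * y ^ k := by
  let F : ℤ → Circle → ℂ := fun n x =>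
    fourierCoeff (fun a : AddCircle (1 : ℝ) => (G (x, AddCircle.toCircle a) : ℂ)) n
  have hrot : ∀ n x, F n (x * Circle.exp (2 * Real.pi * θ))
      = ((c * x ^ ((k - n) * d) * Circle.exp (-n * (2 * Real.pi * f x)) : Circle) : ℂ) * F n x := by
    intro n x
    obtain ⟨b, hb⟩ := UnitAddCircle.exists_toCircle_eq (x ^ d * Circle.exp (2 * Real.pi * f x))
    have hG' : ∀ a : AddCircle (1 : ℝ),
        (G (x * Circle.exp (2 * Real.pi * θ), AddCircle.toCircle (a + b)) : ℂ)
          = ((c * x ^ (k * d) : Circle) : ℂ) * G (x, AddCircle.toCircle a) := fun a => by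
      rw [← Circle.coe_mul, ← h, furstenberg, AddCircle.toCircle_add, hb]
      congr 3
      simp only [mul_assoc, mul_left_comm]
    simp only [F]
    rw [fourierCoeff_translate _ b]
    simp only [hG']
    rw [fourierCoeff.const_mul, ← mul_assoc, fourier_apply, AddCircle.toCircle_zsmul, hb,
      ← Circle.coe_mul]
    congr 2
    rw [mul_zpow, ← Int.cast_neg, Circle.exp_intCast_mul, ← zpow_mul, sub_mul, sub_eq_add_neg,
      zpow_add]
    rw [mul_comm d, neg_mul]
    rw [mul_comm, ← mul_assoc c, mul_assoc (c * _)]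
  have hcont : Continuous fun p => (G p : ℂ) := by fun_prop
  have hzero : ∀ n ≠ k, F n x = 0 := fun n hn =>
    Circle.eq_zero_of_rotation_eq_mul hθ (continuous_fourierCoeff_comp_toCircle hcont n)
      (mul_ne_zero (sub_ne_zero.2 hn.symm) hd) (by fun_prop) c (hrot n) x
  have hfib := eq_fourierCoeff_mul_of_forall_ne
    (u := fun a : AddCircle (1 : ℝ) => (G (x, AddCircle.toCircle a) : ℂ)) (by fun_prop) hzero
  have h0 := hfib 0
  obtain ⟨a, rfl⟩ := UnitAddCircle.exists_toCircle_eq y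
  apply Circle.ext
  rw [fourier_eval_zero, mul_one, AddCircle.toCircle_zero] at h0
  rw [hfib a, ← h0, fourier_apply, AddCircle.toCircle_zsmul, Circle.coe_mul]

/-- The mean value of a coboundary over a rotation is zero. -/
theorem circleMean_eq_of_add_sub_eq {θ C : ℝ} {f h : Circle → ℝ} (hh : Continuous h)
    (hC : ∀ x, h (x * Circle.exp (2 * Real.pi * θ)) + f x - h x = C) : circleMean f = C := by
  have hper : Function.Periodic (fun t : ℝ => h (Circle.exp (2 * Real.pi * t))) 1 := fun t => by
    simp only [mul_add, mul_one, Circle.exp_add_two_pi]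
  have hshift : ∫ t in (0 : ℝ)..1, h (Circle.exp (2 * Real.pi * (t + θ)))
      = ∫ t in (0 : ℝ)..1, h (Circle.exp (2 * Real.pi * t)) := by
    rw [intervalIntegral.integral_comp_add_right
      (fun t => h (Circle.exp (2 * Real.pi * t))) θ, zero_add, add_comm 1 θ,
      hper.intervalIntegral_add_eq θ 0, zero_add]
  have hfe : ∀ t : ℝ, f (Circle.exp (2 * Real.pi * t)) = C + h (Circle.exp (2 * Real.pi * t))
      - h (Circle.exp (2 * Real.pi * (t + θ))) := fun t => by
    rw [← hC (Circle.exp (2 * Real.pi * t)), mul_add, Circle.exp_add]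
    ring
  have hi : ∀ {u : ℝ → ℝ}, Continuous u → IntervalIntegrable u volume 0 1 :=
    fun hu => hu.intervalIntegrable _ _
  unfold circleMean
  simp only [hfe]
  rw [intervalIntegral.integral_sub (hi (by fun_prop)) (hi (by fun_prop)),
    intervalIntegral.integral_add (hi (by fun_prop)) (hi (by fun_prop)), hshift]
  simp

theorem furstenberg_topologically_conjugate_iff_splits
    (θ : ℝ) (hθ : Irrational θ) (d : ℤ) (hd : d ≠ 0) (f : Circle → ℝ)
    (hf : ContDiff ℝ (⊤ : ℕ∞) fun t : ℝ => f (Circle.exp (2 * Real.pi * t))) :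
    (∃ ψ : Circle × Circle → Circle × Circle, Continuous ψ ∧
        ψ ∘ furstenberg θ d f = furstenberg θ d 0 ∘ ψ) ↔
    (∃ g : Circle → ℝ, Continuous g ∧
        ∀ x : Circle, g x - g (Circle.exp (2 * Real.pi * θ) * x) = f x - circleMean f) := by
  have hfc : Continuous f := by
    apply Circle.continuous_of_comp_exp
    have := hf.continuous.comp (continuous_id.div_const (2 * Real.pi))
    convert this using 2 with t
    simp [mul_div_cancel₀, Real.pi_ne_zero]
  constructor
  · rintro ⟨ψ, hψ, hconj⟩
    have hconj' : ∀ x y, ψ (furstenberg θ d f (x, y)) = furstenberg θ d 0 (ψ (x, y)) :=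
      fun x y => congrFun hconj (x, y)
    have h₁ := eq_mul_zpow_of_furstenberg hθ hd hfc hψ.fst (Circle.exp (2 * Real.pi * θ)) 0
      fun x y => by rw [hconj']; simp [furstenberg, mul_comm]
    obtain ⟨c, hc⟩ : ∃ c, ∀ x y, (ψ (x, y)).1 = c * x := by
      refine ⟨(ψ (1, 1)).1, fun x y => ?_⟩
      have := Circle.eq_of_irrational_rotation_invariant hθ
        (u := fun x => (ψ (x, 1)).1 / x) (by fun_prop) (fun x => by
          have h₂ := congrArg Prod.fst (hconj' x 1)
          simp only [furstenberg] at h₂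
          rw [h₁, zpow_zero, mul_one] at h₂
          simp [h₂]) x
      rw [h₁, zpow_zero, mul_one, ← div_eq_iff_eq_mul]
      simpa using this
    have h₂ : ∀ x y, (ψ (furstenberg θ d f (x, y))).2 = c ^ d * x ^ d * (ψ (x, y)).2 :=
      fun x y => by rw [hconj']; simp [furstenberg, hc, mul_zpow]
    have h₃ := eq_mul_zpow_of_furstenberg hθ hd hfc hψ.snd (c ^ d) 1
      fun x y => by rw [h₂, one_mul]
    obtain ⟨m, h, hh, hW⟩ := Circle.exists_eq_zpow_mul_exp
      (W := fun x => (ψ (x, 1)).2) (by fun_prop)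
    have hexp : ∀ x, Circle.exp (h (x * Circle.exp (2 * Real.pi * θ)) + 2 * Real.pi * f x - h x)
        = c ^ d / Circle.exp (2 * Real.pi * θ) ^ m := fun x => by
      have h₄ := h₂ x 1
      simp only [furstenberg] at h₄
      rw [h₃] at h₄
      rw [hW, hW, mul_zpow, zpow_one, mul_one] at h₄
      rw [Circle.exp_sub, Circle.exp_add, div_eq_div_iff_mul_eq_mul, ← mul_right_inj (x ^ d),
        ← mul_right_inj (x ^ m)]
      simp only [mul_assoc, mul_comm, mul_left_comm] at h₄ ⊢
      exact h₄
    have hg : Continuous fun x => h x / (2 * Real.pi) := by fun_prop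
    have hC : ∀ x, h (x * Circle.exp (2 * Real.pi * θ)) / (2 * Real.pi) + f x - h x / (2 * Real.pi)
        = (h (1 * Circle.exp (2 * Real.pi * θ)) + 2 * Real.pi * f 1 - h 1) / (2 * Real.pi) :=
      fun x => by
        rw [← Circle.eq_of_exp_comp_eq (by fun_prop) hexp x 1]
        field_simp
    refine ⟨_, hg, fun x => ?_⟩
    rw [circleMean_eq_of_add_sub_eq hg hC, ← hC x, mul_comm x]
    ring
  · rintro ⟨g, hg, hgf⟩
    have hcd : Circle.exp (2 * Real.pi * circleMean f / d) ^ d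
        = Circle.exp (2 * Real.pi * circleMean f) := by
      rw [← Circle.exp_intCast_mul, mul_div_cancel₀ _ (Int.cast_ne_zero.2 hd)]
    refine ⟨fun p => (Circle.exp (2 * Real.pi * circleMean f / d) * p.1,
      p.2 * Circle.exp (2 * Real.pi * g p.1)), by fun_prop, ?_⟩
    ext1 ⟨x, y⟩
    have hx : Circle.exp (2 * Real.pi * f x)
          * Circle.exp (2 * Real.pi * g (x * Circle.exp (2 * Real.pi * θ)))
        = Circle.exp (2 * Real.pi * circleMean f) * Circle.exp (2 * Real.pi * g x) := by
      rw [← Circle.exp_add, ← Circle.exp_add, mul_comm x]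
      congr 1
      linear_combination (-2 * Real.pi) * hgf x
    simp only [Function.comp_apply, furstenberg, Pi.zero_apply, mul_zero, Circle.exp_zero, mul_one,
      Prod.mk.injEq]
    refine ⟨(mul_assoc _ _ _).symm, ?_⟩
    rw [mul_zpow, hcd, mul_assoc _ (Circle.exp _), hx]
    simp only [mul_assoc, mul_comm, mul_left_comm]
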